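/- (Lemma 2, approximation of an indicator of a square by a double Walsh polynomial) For any real γ ≠ 0, any 0 < δ < 1, any integer N > 1, and any dyadic square Δ = Δ_1 × Δ_2 ⊆ T = [0,1]^2, there exist a measurable set E ⊆ T and a double Walsh polynomial P(x,y) = ∑_{k,s=N}^M c_{k,s} W_k(x)W_s(y) such that: (1) |E| > 1 − δ; (2) ∑_{k,s=N}^M |c_{k,s}|^{2+δ} < δ; (3) P(x,y) = γ·χ_Δ(x,y) for (x,y) ∈ E; and (4) for every measurable subset e ⊆ E, the maximum over N ≤ n̄, m̄ ≤ M of ∫∫_e |∑_{k,s=N}^{n̄,m̄} c_{k,s}W_k(x)W_s(y)| dxdy plus the maximum over √2·N ≤ R ≤ √2·M of ∫∫_e |∑_{2N² ≤ k²+s² ≤ R²} c_{k,s}W_k(x)W_s(y)| dxdy is at most 16·|γ|·|Δ|. -/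

import Mathlib

open MeasureTheory Real
open scoped ENNReal Classical

/-- The basic Rademacher function: 1-periodic, equal to `1` on `[0,1/2)` and `-1` on `[1/2,1)`. -/
noncomputable def rad0 (x : ℝ) : ℝ := if Int.fract x < 1/2 then 1 else -1

/-- The Rademacher functions `r_k(x) = r_0(2^k x)`. -/
noncomputable def rad (k : ℕ) (x : ℝ) : ℝ := rad0 (2 ^ k * x)

/-- The Walsh–Paley functions: `W_n = ∏ r_m` over the binary digits `m` of `n`. -/
noncomputable def walsh (n : ℕ) (x : ℝ) : ℝ :=
  ∏ m ∈ Finset.range (n + 1), if n.testBit m then rad m x else 1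

/-- The unit square `T = [0,1]²`. -/
def T : Set (ℝ × ℝ) := Set.Icc (0:ℝ) 1 ×ˢ Set.Icc (0:ℝ) 1

theorem rad_cases (k : ℕ) (x : ℝ) : rad k x = 1 ∨ rad k x = -1 := by
  unfold rad rad0; split_ifs <;> simp

theorem rad_mul_self (k : ℕ) (x : ℝ) : rad k x * rad k x = 1 := by
  rcases rad_cases k x with h | h <;> rw [h] <;> norm_num

theorem rad0_add_nat (x : ℝ) (n : ℕ) : rad0 (x + n) = rad0 x := by
  unfold rad0; rw [Int.fract_add_natCast]

theorem rad0_add_half (x : ℝ) : rad0 (x + 1/2) = - rad0 x := by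
  unfold rad0
  have h0 := Int.fract_nonneg x
  have h1 := Int.fract_lt_one x
  by_cases h : Int.fract x < 1/2
  · have : Int.fract (x + 1/2) = Int.fract x + 1/2 := by
      rw [Int.fract_eq_iff]
      refine ⟨by linarith, by linarith, ⌊x⌋, ?_⟩
      have := Int.self_sub_floor x
      linarith
    rw [this, if_neg (by linarith), if_pos h]
  · have : Int.fract (x + 1/2) = Int.fract x - 1/2 := by
      rw [Int.fract_eq_iff]
      refine ⟨by linarith, by linarith, ⌊x⌋ + 1, ?_⟩
      have := Int.self_sub_floor x
      push_cast
      linarith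
    rw [this, if_pos (by linarith), if_neg h]; norm_num

theorem rad_measurable (k : ℕ) : Measurable (rad k) := by
  unfold rad rad0
  refine Measurable.ite (measurableSet_lt ?_ measurable_const) measurable_const measurable_const
  exact measurable_fract.comp (measurable_const.mul measurable_id)

theorem walsh_measurable (n : ℕ) : Measurable (walsh n) := by
  unfold walsh
  refine Finset.measurable_fun_prod _ fun m _ => ?_
  split_ifs
  · exact rad_measurable m
  · exact measurable_const

theorem walsh_eq (n K : ℕ) (h : n < 2 ^ K) (x : ℝ) :
    walsh n x = ∏ m ∈ Finset.range K, if n.testBit m then rad m x else 1 := by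
  have key : ∀ K K' : ℕ, n < 2 ^ K → K ≤ K' →
      (∏ m ∈ Finset.range K, if n.testBit m then rad m x else 1) =
      ∏ m ∈ Finset.range K', if n.testBit m then rad m x else 1 := by
    intro K K' h hK
    refine Finset.prod_subset (Finset.range_mono hK) fun m _ hm => ?_
    rw [Nat.testBit_lt_two_pow]
    · simp
    · simp at hm
      exact h.trans_le (Nat.pow_le_pow_right (by norm_num) hm)
  have h1 : n < 2 ^ (n+1) := (Nat.lt_two_pow_self).trans_le (Nat.pow_le_pow_right (by norm_num) (by omega))
  unfold walsh
  rw [key (n+1) (max (n+1) K) h1 (le_max_left _ _), key K (max (n+1) K) h (le_max_right _ _)]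

theorem walsh_mul (k l : ℕ) (x : ℝ) : walsh k x * walsh l x = walsh (k ^^^ l) x := by
  have hk : k < 2 ^ (max k l) := (Nat.lt_two_pow_self).trans_le (Nat.pow_le_pow_right (by norm_num) (by omega))
  have hl : l < 2 ^ (max k l) := (Nat.lt_two_pow_self).trans_le (Nat.pow_le_pow_right (by norm_num) (by omega))
  rw [walsh_eq k _ hk, walsh_eq l _ hl, walsh_eq _ _ (Nat.xor_lt_two_pow hk hl), ← Finset.prod_mul_distrib]
  refine Finset.prod_congr rfl fun m _ => ?_
  rw [Nat.testBit_xor]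
  cases k.testBit m <;> cases l.testBit m <;> simp [rad_mul_self]

theorem walsh_zero (x : ℝ) : walsh 0 x = 1 := by
  simp [walsh]

theorem walsh_two_pow (l : ℕ) (x : ℝ) : walsh (2 ^ l) x = rad l x := by
  rw [walsh_eq (2 ^ l) (l+1) (Nat.pow_lt_pow_right (by norm_num) (by omega)), Finset.prod_eq_single l]
  · simp
  · intro b _ hb
    rw [Nat.testBit_two_pow_of_ne (Ne.symm hb)]; simp
  · simp

theorem walsh_mul_self (k : ℕ) (x : ℝ) : walsh k x * walsh k x = 1 := by
  rw [walsh_mul, Nat.xor_self, walsh_zero]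

theorem walsh_abs (k : ℕ) (x : ℝ) : |walsh k x| = 1 := by
  have := walsh_mul_self k x
  rcases mul_self_eq_one_iff.1 this with h | h <;> rw [h] <;> simp

theorem walsh_periodic (n : ℕ) : Function.Periodic (walsh n) 1 := by
  intro x
  unfold walsh
  refine Finset.prod_congr rfl fun m _ => ?_
  have : rad m (x + 1) = rad m x := by
    unfold rad
    have := rad0_add_nat (2 ^ m * x) (2 ^ m)
    push_cast at this
    rw [← this]; ring_nf
  rw [this]

theorem walsh_shift (n : ℕ) (hn : n ≠ 0) : ∃ h : ℝ, ∀ x, walsh n (x + h) = - walsh n x := by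
  have hex : ∃ i, n.testBit i = true := Nat.exists_testBit_of_ne_zero hn
  set l := Nat.find hex with hl
  have hb : n.testBit l = true := Nat.find_spec hex
  refine ⟨1 / 2 ^ (l+1), fun x => ?_⟩
  have hlt : l < n + 1 := by
    by_contra hcon
    have : n < 2 ^ l := (Nat.lt_two_pow_self).trans_le (Nat.pow_le_pow_right (by norm_num) (by omega))
    rw [Nat.testBit_lt_two_pow this] at hb
    exact absurd hb (by simp)
  unfold walsh
  rw [← Finset.mul_prod_erase _ _ (Finset.mem_range.2 hlt), ← Finset.mul_prod_erase (Finset.range (n+1)) _ (Finset.mem_range.2 hlt)]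
  rw [if_pos hb, if_pos hb]
  have h1 : rad l (x + 1 / 2 ^ (l+1)) = - rad l x := by
    unfold rad
    rw [← rad0_add_half]; congr 1; rw [pow_succ]; field_simp
  have h2 : (∏ m ∈ (Finset.range (n+1)).erase l, if n.testBit m then rad m (x + 1 / 2 ^ (l+1)) else 1)
     = ∏ m ∈ (Finset.range (n+1)).erase l, if n.testBit m then rad m x else 1 := by
    refine Finset.prod_congr rfl fun m hm => ?_
    split_ifs with hbm
    · have h3 : l ≤ m := Nat.find_min' hex hbm
      have h4 : l ≠ m := fun h => (Finset.mem_erase.1 hm).1 h.symm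
      obtain ⟨d, rfl⟩ : ∃ d, m = l + 1 + d := ⟨m - (l+1), by omega⟩
      unfold rad
      have := rad0_add_nat (2 ^ (l+1+d) * x) (2 ^ d)
      push_cast at this
      rw [← this]; congr 1; rw [pow_add]; field_simp
    · rfl
  rw [h1, h2]; ring

noncomputable def mu1 : Measure ℝ := volume.restrict (Set.Ico 0 1)
instance : IsProbabilityMeasure mu1 := ⟨by simp [mu1]⟩
noncomputable def mu : Measure (ℝ × ℝ) := mu1.prod mu1
instance : IsProbabilityMeasure mu := by unfold mu; infer_instance

theorem mu_eq : mu = volume.restrict (Set.Ico (0:ℝ) 1 ×ˢ Set.Ico (0:ℝ) 1) := by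
  unfold mu mu1
  rw [Measure.prod_restrict, Measure.volume_eq_prod]

theorem walsh_integral (n : ℕ) (hn : n ≠ 0) : ∫ x, walsh n x ∂mu1 = 0 := by
  unfold mu1
  rw [integral_Ico_eq_integral_Ioc, ← intervalIntegral.integral_of_le zero_le_one]
  obtain ⟨h, hh⟩ := walsh_shift n hn
  have h1 : ∫ x in (0:ℝ)..1, walsh n (x + h) = ∫ x in (0:ℝ)..1, walsh n x := by
    rw [intervalIntegral.integral_comp_add_right]
    have := (walsh_periodic n).intervalIntegral_add_eq (0 + h) 0
    rw [add_comm 1 h]; simpa using this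
  simp_rw [hh] at h1
  rw [intervalIntegral.integral_neg] at h1
  linarith

theorem walsh_orth (k l : ℕ) : ∫ x, walsh k x * walsh l x ∂mu1 = if k = l then 1 else 0 := by
  split_ifs with h
  · subst h; simp [walsh_mul_self]
  · simp_rw [walsh_mul]
    exact walsh_integral _ (by rwa [Ne, Nat.xor_eq_zero_iff])

/-- double Walsh function -/
noncomputable def psi (a : ℕ × ℕ) (p : ℝ × ℝ) : ℝ := walsh a.1 p.1 * walsh a.2 p.2

theorem psi_measurable (a : ℕ × ℕ) : Measurable (psi a) :=
  ((walsh_measurable _).comp measurable_fst).mul ((walsh_measurable _).comp measurable_snd)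

theorem psi_abs (a : ℕ × ℕ) (p : ℝ × ℝ) : |psi a p| = 1 := by
  simp [psi, abs_mul, walsh_abs]

theorem psi_mul (a b : ℕ × ℕ) : psi a * psi b = psi (a.1 ^^^ b.1, a.2 ^^^ b.2) := by
  funext p
  simp only [Pi.mul_apply, psi, ← walsh_mul]; ring

theorem psi_orth (a b : ℕ × ℕ) : ∫ p, psi a p * psi b p ∂mu = if a = b then 1 else 0 := by
  have : (fun p : ℝ × ℝ => psi a p * psi b p) =
    fun p => (fun x => walsh a.1 x * walsh b.1 x) p.1 * (fun y => walsh a.2 y * walsh b.2 y) p.2 := by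
    funext p; simp only [psi]; ring
  rw [this]; unfold mu
  rw [integral_prod_mul (fun x => walsh a.1 x * walsh b.1 x) (fun y => walsh a.2 y * walsh b.2 y), walsh_orth, walsh_orth]
  rcases a with ⟨a1, a2⟩; rcases b with ⟨b1, b2⟩
  simp only [Prod.mk.injEq]
  split_ifs <;> simp_all

/-- bounded measurable -/
theorem integrable_bdd {f : ℝ × ℝ → ℝ} (hf : Measurable f) (C : ℝ) (h : ∀ p, |f p| ≤ C) : Integrable f mu :=
  Integrable.of_bound hf.aestronglyMeasurable C (Filter.Eventually.of_forall h)

theorem psi_integrable (a : ℕ × ℕ) : Integrable (psi a) mu :=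
  integrable_bdd (psi_measurable a) 1 fun p => (psi_abs a p).le

noncomputable def poly (c : ℕ × ℕ → ℝ) (S : Finset (ℕ × ℕ)) (p : ℝ × ℝ) : ℝ := ∑ a ∈ S, c a * psi a p

theorem poly_measurable (c S) : Measurable (poly c S) := by
  unfold poly
  exact Finset.measurable_fun_sum _ fun a _ => measurable_const.mul (psi_measurable a)

theorem poly_abs (c S) (p) : |poly c S p| ≤ ∑ a ∈ S, |c a| := by
  unfold poly
  refine (Finset.abs_sum_le_sum_abs _ _).trans (Finset.sum_le_sum fun a _ => ?_)
  rw [abs_mul, psi_abs, mul_one]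

theorem poly_integrable (c S) : Integrable (poly c S) mu :=
  integrable_bdd (poly_measurable c S) _ (poly_abs c S)

theorem poly_mul_psi (c S) (b : ℕ × ℕ) (hb : b ∈ S) : ∫ p, poly c S p * psi b p ∂mu = c b := by
  unfold poly
  simp_rw [Finset.sum_mul, mul_assoc]
  rw [integral_finsetSum]
  · simp_rw [integral_const_mul, psi_orth]
    simp [hb]
  · intro a _
    refine Integrable.const_mul ?_ _
    exact integrable_bdd ((psi_measurable a).mul (psi_measurable b)) 1 fun p => by simp [abs_mul, psi_abs]

theorem poly_parseval (c S) : ∫ p, (poly c S p) ^ 2 ∂mu = ∑ a ∈ S, c a ^ 2 := by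
  have : ∀ p, poly c S p ^ 2 = ∑ a ∈ S, c a * (poly c S p * psi a p) := by
    intro p
    rw [sq]; nth_rw 2 [poly]
    rw [Finset.mul_sum]
    exact Finset.sum_congr rfl fun a _ => by ring
  simp_rw [this]
  rw [integral_finsetSum]
  · refine Finset.sum_congr rfl fun a ha => ?_
    rw [integral_const_mul, poly_mul_psi c S a ha]; ring
  · intro a _
    refine Integrable.const_mul ?_ _
    exact integrable_bdd ((poly_measurable c S).mul (psi_measurable a)) _ fun p => by
      simp only [abs_mul, psi_abs, mul_one]; exact poly_abs c S p

theorem poly_coeff_le (c S) (b : ℕ × ℕ) (hb : b ∈ S) : |c b| ≤ ∫ p, |poly c S p| ∂mu := by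
  rw [← poly_mul_psi c S b hb]
  refine abs_integral_le_integral_abs.trans (le_of_eq ?_)
  simp [abs_mul, psi_abs]

theorem poly_L1_le (c S) : ∫ p, |poly c S p| ∂mu ≤ Real.sqrt (∑ a ∈ S, c a ^ 2) := by
  rw [← poly_parseval]
  refine Real.le_sqrt_of_sq_le ?_
  set I := ∫ p, |poly c S p| ∂mu with hI
  have h1 : Integrable (fun p => |poly c S p|) mu := (poly_integrable c S).abs
  have h2 : Integrable (fun p => poly c S p ^ 2) mu := by
    refine integrable_bdd ((poly_measurable c S).pow_const 2) ((∑ a ∈ S, |c a|)^2) fun p => ?_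
    rw [abs_pow]
    exact pow_le_pow_left₀ (abs_nonneg _) (poly_abs c S p) 2
  have h3 : 0 ≤ ∫ p, (|poly c S p| - I) ^ 2 ∂mu := integral_nonneg fun p => sq_nonneg _
  have h4 : ∀ p, (|poly c S p| - I) ^ 2 = (poly c S p ^ 2 - 2 * I * |poly c S p|) + I ^ 2 := by
    intro p
    rw [← sq_abs (poly c S p)]; ring
  simp_rw [h4] at h3
  have h5 : Integrable (fun p => poly c S p ^ 2 - 2 * I * |poly c S p|) mu := h2.sub (h1.const_mul _)
  rw [integral_add h5 (integrable_const _), integral_sub h2 (h1.const_mul _), integral_const_mul, ← hI] at h3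
  simp at h3
  nlinarith

noncomputable def V (lo hi : ℕ) : Submodule ℝ (ℝ × ℝ → ℝ) :=
  Submodule.span ℝ (psi '' {a | (lo ≤ a.1 ∧ a.1 < hi) ∧ (lo ≤ a.2 ∧ a.2 < hi)})

theorem V_mono {lo hi lo' hi' : ℕ} (h : lo' ≤ lo) (h' : hi ≤ hi') : V lo hi ≤ V lo' hi' := by
  refine Submodule.span_mono (Set.image_mono ?_)
  rintro a ⟨⟨h1, h2⟩, h3, h4⟩
  exact ⟨⟨by omega, by omega⟩, by omega, by omega⟩

theorem psi_mem_V {lo hi : ℕ} {a : ℕ × ℕ} (h1 : lo ≤ a.1) (h2 : a.1 < hi) (h3 : lo ≤ a.2) (h4 : a.2 < hi) :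
    psi a ∈ V lo hi := Submodule.subset_span ⟨a, ⟨⟨h1, h2⟩, h3, h4⟩, rfl⟩

theorem V_mul {lo hi lo' hi' lo'' hi'' : ℕ} {f g : ℝ × ℝ → ℝ}
    (h : ∀ k l, lo ≤ k → k < hi → lo' ≤ l → l < hi' → lo'' ≤ k ^^^ l ∧ k ^^^ l < hi'')
    (hf : f ∈ V lo hi) (hg : g ∈ V lo' hi') : f * g ∈ V lo'' hi'' := by
  have := Submodule.mul_mem_mul hf hg
  unfold V at this
  rw [Submodule.span_mul_span] at this
  refine (Submodule.span_mono ?_) this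
  rintro _ ⟨_, ⟨a, ⟨⟨h1, h2⟩, h3, h4⟩, rfl⟩, _, ⟨b, ⟨⟨h5, h6⟩, h7, h8⟩, rfl⟩, rfl⟩
  refine ⟨(a.1 ^^^ b.1, a.2 ^^^ b.2), ⟨?_, ?_⟩, (psi_mul a b).symm⟩
  · exact h _ _ h1 h2 h5 h6
  · exact h _ _ h3 h4 h7 h8

theorem V_mul_low {q : ℕ} {f g : ℝ × ℝ → ℝ}
    (hf : f ∈ V 0 (2 ^ q)) (hg : g ∈ V 0 (2 ^ q)) : f * g ∈ V 0 (2 ^ q) :=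
  V_mul (fun _ _ _ h1 _ h2 => ⟨Nat.zero_le _, Nat.xor_lt_two_pow h1 h2⟩) hf hg

theorem V_mul_high {q q' : ℕ} (hq : q ≤ q') {f g : ℝ × ℝ → ℝ}
    (hf : f ∈ V 0 (2 ^ q)) (hg : g ∈ V (2 ^ q) (2 ^ q')) : f * g ∈ V (2 ^ q) (2 ^ q') := by
  refine V_mul (fun k l _ h1 h2 h3 => ⟨?_, ?_⟩) hf hg
  · by_contra hcon
    push Not at hcon
    have := Nat.xor_lt_two_pow h1 hcon
    rw [← Nat.xor_assoc, Nat.xor_self, Nat.zero_xor] at this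
    omega
  · exact Nat.xor_lt_two_pow (h1.trans_le (Nat.pow_le_pow_right (by norm_num) hq)) h3

theorem V_coeff {lo hi : ℕ} {f : ℝ × ℝ → ℝ} (hf : f ∈ V lo hi) :
    ∃ c : ℕ × ℕ → ℝ, f = poly c (Finset.Ico lo hi ×ˢ Finset.Ico lo hi) := by
  unfold V at hf
  induction hf using Submodule.span_induction with
  | mem x h =>
    obtain ⟨a, ⟨⟨h1, h2⟩, h3, h4⟩, rfl⟩ := h
    refine ⟨fun b => if b = a then 1 else 0, ?_⟩
    funext p
    simp [poly]
    intro h; exfalso; omega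
  | zero => exact ⟨0, by funext p; simp [poly]⟩
  | add x y _ _ hx hy =>
    obtain ⟨c, rfl⟩ := hx
    obtain ⟨d, rfl⟩ := hy
    exact ⟨c + d, by funext p; simp [poly, add_mul, Finset.sum_add_distrib]⟩
  | smul r x _ hx =>
    obtain ⟨c, rfl⟩ := hx
    exact ⟨r • c, by funext p; simp [poly, Finset.mul_sum, mul_assoc]⟩

noncomputable def Zf (m u v : ℕ) (p : ℝ × ℝ) : ℝ :=
  ∏ l ∈ Finset.range m, ((1 + rad l (u / 2 ^ m) * rad l p.1) / 2 * ((1 + rad l (v / 2 ^ m) * rad l p.2) / 2))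

noncomputable def Hf (q ν : ℕ) (p : ℝ × ℝ) : ℝ :=
  ∏ l ∈ Finset.range ν, (1 + rad (q + l) p.1 * rad (q + l) p.2)

theorem one_mem_V (q : ℕ) : (1 : ℝ × ℝ → ℝ) ∈ V 0 (2 ^ q) := by
  have : (1 : ℝ × ℝ → ℝ) = psi (0, 0) := by funext p; simp [psi, walsh_zero]
  rw [this]
  exact psi_mem_V (by simp) (by simp) (by simp) (by simp)

theorem radx_mem_V {l q : ℕ} (h : l < q) : (fun p : ℝ × ℝ => rad l p.1) ∈ V 0 (2 ^ q) := by
  have : (fun p : ℝ × ℝ => rad l p.1) = psi (2 ^ l, 0) := by funext p; simp [psi, walsh_zero, walsh_two_pow]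
  rw [this]
  exact psi_mem_V (by simp) (Nat.pow_lt_pow_right (by norm_num) h) (by simp) (by simp)

theorem rady_mem_V {l q : ℕ} (h : l < q) : (fun p : ℝ × ℝ => rad l p.2) ∈ V 0 (2 ^ q) := by
  have : (fun p : ℝ × ℝ => rad l p.2) = psi (0, 2 ^ l) := by funext p; simp [psi, walsh_zero, walsh_two_pow]
  rw [this]
  exact psi_mem_V (by simp) (by simp) (by simp) (Nat.pow_lt_pow_right (by norm_num) h)

theorem Zf_mem_V (m u v : ℕ) : Zf m u v ∈ V 0 (2 ^ m) := by
  have h0 : Zf m u v = ∏ l ∈ Finset.range m, (((1/2 : ℝ) • ((1 : ℝ × ℝ → ℝ) + (rad l (u / 2 ^ m)) • (fun p : ℝ × ℝ => rad l p.1)))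
      * ((1/2 : ℝ) • ((1 : ℝ × ℝ → ℝ) + (rad l (v / 2 ^ m)) • (fun p : ℝ × ℝ => rad l p.2)))) := by
    funext p
    rw [Finset.prod_apply]
    unfold Zf
    refine Finset.prod_congr rfl fun l _ => ?_
    simp; ring
  rw [h0]
  refine Finset.prod_induction _ (fun f => f ∈ V 0 (2 ^ m)) (fun _ _ => V_mul_low) (one_mem_V m) ?_
  intro l hl
  have hl := Finset.mem_range.1 hl
  refine V_mul_low ?_ ?_
  · exact Submodule.smul_mem _ _ (Submodule.add_mem _ (one_mem_V m) (Submodule.smul_mem _ _ (radx_mem_V hl)))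
  · exact Submodule.smul_mem _ _ (Submodule.add_mem _ (one_mem_V m) (Submodule.smul_mem _ _ (rady_mem_V hl)))

theorem Hf_mem_V (q ν : ℕ) : Hf q ν - 1 ∈ V (2 ^ q) (2 ^ (q + ν)) := by
  induction ν with
  | zero =>
    have : Hf q 0 - 1 = 0 := by funext p; simp [Hf]
    rw [this]; exact Submodule.zero_mem _
  | succ n ih =>
    have h1 : Hf q (n+1) - 1 = (Hf q n - 1) + Hf q n * psi (2 ^ (q+n), 2 ^ (q+n)) := by
      funext p
      simp only [Hf, Finset.prod_range_succ, psi, walsh_two_pow, Pi.sub_apply, Pi.add_apply, Pi.mul_apply, Pi.one_apply]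
      ring
    have hle : 2 ^ (q + n) ≤ 2 ^ (q + (n+1)) := Nat.pow_le_pow_right (by norm_num) (by omega)
    have hlt : 2 ^ (q + n) < 2 ^ (q + (n+1)) := Nat.pow_lt_pow_right (by norm_num) (by omega)
    have hq : 2 ^ q ≤ 2 ^ (q + n) := Nat.pow_le_pow_right (by norm_num) (by omega)
    rw [h1]
    refine Submodule.add_mem _ (V_mono le_rfl hle ih) ?_
    have h2 : Hf q n ∈ V 0 (2 ^ (q + n)) := by
      have := Submodule.add_mem _ (V_mono (Nat.zero_le _) le_rfl ih) (one_mem_V (q+n))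
      simpa using this
    refine V_mono hq le_rfl (V_mul_high (by omega) h2 ?_)
    exact psi_mem_V le_rfl hlt le_rfl hlt

theorem block_mem_V (m u v q ν : ℕ) (h : m ≤ q) : Zf m u v * (1 - Hf q ν) ∈ V (2 ^ q) (2 ^ (q + ν)) := by
  refine V_mul_high (by omega) (V_mono le_rfl (Nat.pow_le_pow_right (by norm_num) h) (Zf_mem_V m u v)) ?_
  have := Submodule.neg_mem _ (Hf_mem_V q ν)
  simpa using this

theorem Hf_cases (q ν : ℕ) (p : ℝ × ℝ) : Hf q ν p = 0 ∨ Hf q ν p = 2 ^ ν := by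
  unfold Hf
  induction ν with
  | zero => simp
  | succ n ih =>
    rw [Finset.prod_range_succ]
    rcases ih with h | h <;> rw [h] <;> rcases rad_cases (q+n) p.1 with h1 | h1 <;>
      rcases rad_cases (q+n) p.2 with h2 | h2 <;> rw [h1, h2] <;> norm_num [pow_succ]

theorem floor_rad (m : ℕ) (x : ℝ) (hx : 0 ≤ x) :
    ⌊2 ^ (m+1) * x⌋₊ = 2 * ⌊2 ^ m * x⌋₊ + (if rad m x = 1 then 0 else 1) := by
  have ht : 0 ≤ 2 ^ m * x := by positivity
  have e : (2:ℝ) ^ (m+1) * x = 2 * (2 ^ m * x) := by ring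
  unfold rad rad0
  rw [e]
  set t := 2 ^ m * x
  have hf : Int.fract t = t - ⌊t⌋₊ := by
    rw [← Int.self_sub_floor, natCast_floor_eq_intCast_floor ht]
  have h1 := Nat.floor_le ht
  have h2 := Nat.lt_floor_add_one t
  rw [Nat.floor_eq_iff (by positivity), hf]
  split_ifs with h3 h4 h4
  · push_cast; constructor <;> linarith
  · norm_num at h4
  · norm_num at h4
  · push_cast; constructor <;> linarith

theorem rad_eq_iff (m : ℕ) (x y : ℝ) (hx : 0 ≤ x) (hx1 : x < 1) (hy : 0 ≤ y) (hy1 : y < 1) :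
    (∀ l < m, rad l y = rad l x) ↔ ⌊2 ^ m * x⌋₊ = ⌊2 ^ m * y⌋₊ := by
  induction m with
  | zero => simp [Nat.floor_eq_zero.2 hx1, Nat.floor_eq_zero.2 hy1]
  | succ n ih =>
    rw [floor_rad n x hx, floor_rad n y hy]
    have : (∀ l < n + 1, rad l y = rad l x) ↔ ((∀ l < n, rad l y = rad l x) ∧ rad n y = rad n x) := by
      constructor
      · intro h; exact ⟨fun l hl => h l (by omega), h n (by omega)⟩
      · rintro ⟨h1, h2⟩ l hl
        rcases Nat.lt_succ_iff_lt_or_eq.1 hl with h | rfl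
        · exact h1 l h
        · exact h2
    rw [this, ih]
    rcases rad_cases n x with h1 | h1 <;> rcases rad_cases n y with h2 | h2 <;> rw [h1, h2] <;> norm_num <;> try omega

theorem prod_rad (m : ℕ) (e : ℕ → ℝ) (he : ∀ l, e l = 1 ∨ e l = -1) (x : ℝ) :
    ∏ l ∈ Finset.range m, ((1 + e l * rad l x) / 2) = if (∀ l < m, e l = rad l x) then 1 else 0 := by
  split_ifs with h
  · refine Finset.prod_eq_one fun l hl => ?_
    rw [h l (Finset.mem_range.1 hl), rad_mul_self]; norm_num
  · push Not at h
    obtain ⟨l, hl, hne⟩ := h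
    refine Finset.prod_eq_zero (Finset.mem_range.2 hl) ?_
    rcases he l with h1 | h1 <;> rcases rad_cases l x with h2 | h2 <;> simp [h1, h2] at hne ⊢

theorem Zf_eq (m u v : ℕ) (hu : u < 2 ^ m) (hv : v < 2 ^ m) (p : ℝ × ℝ)
    (hp : p ∈ Set.Ico (0:ℝ) 1 ×ˢ Set.Ico (0:ℝ) 1) :
    Zf m u v p = if ⌊2 ^ m * p.1⌋₊ = u ∧ ⌊2 ^ m * p.2⌋₊ = v then 1 else 0 := by
  obtain ⟨⟨hx0, hx1⟩, hy0, hy1⟩ := hp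
  have key : ∀ u : ℕ, u < 2 ^ m → ∀ x : ℝ, 0 ≤ x → x < 1 →
      ((∀ l < m, rad l ((u:ℝ) / 2 ^ m) = rad l x) ↔ ⌊2 ^ m * x⌋₊ = u) := by
    intro u hu x hx hx1
    have hu' : (u:ℝ) < 2 ^ m := by exact_mod_cast hu
    rw [rad_eq_iff m x (u / 2 ^ m) hx hx1 (by positivity) (by rw [div_lt_one (by positivity)]; exact hu')]
    rw [mul_div_cancel₀ _ (by positivity), Nat.floor_natCast]
  unfold Zf
  rw [Finset.prod_mul_distrib, prod_rad m (fun l => rad l (u / 2 ^ m)) (fun l => rad_cases _ _),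
    prod_rad m (fun l => rad l (v / 2 ^ m)) (fun l => rad_cases _ _)]
  simp only [key u hu p.1 hx0 hx1, key v hv p.2 hy0 hy1]
  split_ifs <;> simp_all

theorem Zf_measurable (m u v : ℕ) : Measurable (Zf m u v) := by
  unfold Zf
  refine Finset.measurable_fun_prod _ fun l _ => ?_
  have h1 := (rad_measurable l).comp (measurable_fst : Measurable (Prod.fst : ℝ × ℝ → ℝ))
  have h2 := (rad_measurable l).comp (measurable_snd : Measurable (Prod.snd : ℝ × ℝ → ℝ))
  exact (((h1.const_mul _).const_add 1).div_const 2).mul (((h2.const_mul _).const_add 1).div_const 2)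

theorem Hf_measurable (q ν : ℕ) : Measurable (Hf q ν) := by
  unfold Hf
  refine Finset.measurable_fun_prod _ fun l _ => ?_
  have h1 := (rad_measurable (q+l)).comp (measurable_fst : Measurable (Prod.fst : ℝ × ℝ → ℝ))
  have h2 := (rad_measurable (q+l)).comp (measurable_snd : Measurable (Prod.snd : ℝ × ℝ → ℝ))
  exact (h1.mul h2).const_add 1

theorem Zf_cases (m u v : ℕ) (p : ℝ × ℝ) : Zf m u v p = 0 ∨ Zf m u v p = 1 := by
  unfold Zf
  rw [Finset.prod_mul_distrib, prod_rad m (fun l => rad l (u / 2 ^ m)) (fun l => rad_cases _ _),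
    prod_rad m (fun l => rad l (v / 2 ^ m)) (fun l => rad_cases _ _)]
  split_ifs <;> simp

theorem ae_mem_Q : ∀ᵐ p ∂mu, p ∈ Set.Ico (0:ℝ) 1 ×ˢ Set.Ico (0:ℝ) 1 := by
  rw [mu_eq]
  exact ae_restrict_mem (measurableSet_Ico.prod measurableSet_Ico)

theorem Zf_integrable (m u v : ℕ) : Integrable (Zf m u v) mu :=
  integrable_bdd (Zf_measurable m u v) 1 fun p => by rcases Zf_cases m u v p with h | h <;> rw [h] <;> simp

theorem Zf_integral (m u v : ℕ) (hu : u < 2 ^ m) (hv : v < 2 ^ m) : ∫ p, Zf m u v p ∂mu ≤ 1 / 4 ^ m := by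
  set A : Set (ℝ × ℝ) := Set.Ico ((u:ℝ) / 2 ^ m) ((u + 1) / 2 ^ m) ×ˢ Set.Ico ((v:ℝ) / 2 ^ m) ((v+1) / 2 ^ m) with hA
  have hAm : MeasurableSet A := measurableSet_Ico.prod measurableSet_Ico
  have h2 : (0:ℝ) < 2 ^ m := by positivity
  have h1 : ∫ p, Zf m u v p ∂mu = ∫ p, A.indicator (fun _ => (1:ℝ)) p ∂mu := by
    refine integral_congr_ae ?_
    filter_upwards [ae_mem_Q] with p hp
    rw [Zf_eq m u v hu hv p hp]
    obtain ⟨⟨hx0, hx1⟩, hy0, hy1⟩ := hp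
    have e1 : 0 ≤ 2 ^ m * p.1 := by positivity
    have e2 : 0 ≤ 2 ^ m * p.2 := by positivity
    rw [Set.indicator_apply]
    simp only [Nat.floor_eq_iff e1, Nat.floor_eq_iff e2]
    simp only [hA, Set.mem_prod, Set.mem_Ico, div_le_iff₀ h2, lt_div_iff₀ h2, mul_comm]
  rw [h1, integral_indicator hAm, setIntegral_const, smul_eq_mul, mul_one]
  have hvol : volume A = ENNReal.ofReal (1 / 4 ^ m) := by
    rw [hA, Measure.volume_eq_prod, Measure.prod_prod, Real.volume_Ico, Real.volume_Ico, ← ENNReal.ofReal_mul]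
    · congr 1
      have : (4:ℝ) ^ m = 2 ^ m * 2 ^ m := by rw [← mul_pow]; norm_num
      rw [this]; field_simp; ring
    · rw [← sub_div]; simp
  have hle : mu A ≤ volume A := by rw [mu_eq]; exact Measure.restrict_apply_le _ _
  rw [hvol] at hle
  exact ENNReal.toReal_le_of_le_ofReal (by positivity) hle

noncomputable def Bf (γ : ℝ) (m q0 ν i : ℕ) (p : ℝ × ℝ) : ℝ :=
  γ * (Zf m (i / 2 ^ m) (i % 2 ^ m) p * (1 - Hf (q0 + i * ν) ν p))

def Sq (q0 ν i : ℕ) : Finset (ℕ × ℕ) :=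
  Finset.Ico (2 ^ (q0 + i * ν)) (2 ^ (q0 + (i + 1) * ν)) ×ˢ Finset.Ico (2 ^ (q0 + i * ν)) (2 ^ (q0 + (i + 1) * ν))

theorem mem_Sq {q0 ν i : ℕ} {a : ℕ × ℕ} : a ∈ Sq q0 ν i ↔
    (2 ^ (q0 + i * ν) ≤ a.1 ∧ a.1 < 2 ^ (q0 + (i + 1) * ν)) ∧ (2 ^ (q0 + i * ν) ≤ a.2 ∧ a.2 < 2 ^ (q0 + (i + 1) * ν)) := by
  simp [Sq]

theorem Sq_lt {q0 ν i j : ℕ} (hij : i < j) {a b : ℕ × ℕ} (ha : a ∈ Sq q0 ν i) (hb : b ∈ Sq q0 ν j) :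
    a.1 < b.1 ∧ a.2 < b.2 := by
  rw [mem_Sq] at ha hb
  have : 2 ^ (q0 + (i + 1) * ν) ≤ 2 ^ (q0 + j * ν) :=
    Nat.pow_le_pow_right (by norm_num) (by have := Nat.mul_le_mul_right ν hij; simp only [Nat.succ_eq_add_one] at this; omega)
  omega

theorem Sq_disj {q0 ν i j : ℕ} {a : ℕ × ℕ} (ha : a ∈ Sq q0 ν i) (hb : a ∈ Sq q0 ν j) : i = j := by
  rcases lt_trichotomy i j with h | h | h
  · have := Sq_lt h ha hb; omega
  · exact h
  · have := Sq_lt h hb ha; omega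

theorem block_coeff (γ : ℝ) (m q0 ν : ℕ) (h : m ≤ q0) : ∃ c : ℕ → ℕ × ℕ → ℝ,
    (∀ i, Bf γ m q0 ν i = poly (c i) (Sq q0 ν i)) ∧ ∀ i, ∀ a ∉ Sq q0 ν i, c i a = 0 := by
  have : ∀ i, ∃ c : ℕ × ℕ → ℝ, Bf γ m q0 ν i = poly c (Sq q0 ν i) ∧ ∀ a ∉ Sq q0 ν i, c a = 0 := by
    intro i
    have h1 := Submodule.smul_mem _ γ (block_mem_V m (i / 2 ^ m) (i % 2 ^ m) (q0 + i * ν) ν (by omega))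
    obtain ⟨c, hc⟩ := V_coeff h1
    refine ⟨fun a => if a ∈ Sq q0 ν i then c a else 0, ?_, fun a ha => by simp [ha]⟩
    have e : q0 + (i + 1) * ν = q0 + i * ν + ν := by ring
    have h2 : Bf γ m q0 ν i = poly c (Sq q0 ν i) := by
      rw [Sq, e, ← hc]; rfl
    rw [h2]; funext p
    unfold poly
    exact Finset.sum_congr rfl fun a ha => by simp [ha]
  choose c h1 h2 using this
  exact ⟨c, h1, h2⟩

theorem idx_bounds {m i : ℕ} (hi : i < 4 ^ m) : i / 2 ^ m < 2 ^ m ∧ i % 2 ^ m < 2 ^ m := by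
  refine ⟨?_, Nat.mod_lt _ (by positivity)⟩
  rw [Nat.div_lt_iff_lt_mul (by positivity), ← mul_pow]; simpa using hi

theorem Bf_abs (γ : ℝ) (m q0 ν i : ℕ) (p : ℝ × ℝ) :
    |Bf γ m q0 ν i p| ≤ |γ| * 2 ^ ν * Zf m (i / 2 ^ m) (i % 2 ^ m) p := by
  unfold Bf
  have h1 : (1:ℝ) ≤ 2 ^ ν := one_le_pow₀ (by norm_num)
  rw [abs_mul, mul_assoc]
  refine mul_le_mul_of_nonneg_left ?_ (abs_nonneg _)
  rcases Zf_cases m (i / 2 ^ m) (i % 2 ^ m) p with h | h <;> rw [h]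
  · simp
  · rcases Hf_cases (q0 + i * ν) ν p with h' | h' <;> rw [h']
    · simpa using h1
    · rw [one_mul, mul_one, abs_le]; constructor <;> linarith

theorem Bf_L1 (γ : ℝ) (m q0 ν i : ℕ) (hi : i < 4 ^ m) :
    ∫ p, |Bf γ m q0 ν i p| ∂mu ≤ |γ| * 2 ^ ν / 4 ^ m := by
  obtain ⟨h1, h2⟩ := idx_bounds hi
  have h3 := Zf_integral m _ _ h1 h2
  calc _ ≤ ∫ p, |γ| * 2 ^ ν * Zf m (i / 2 ^ m) (i % 2 ^ m) p ∂mu :=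
        integral_mono_of_nonneg (Filter.Eventually.of_forall fun p => abs_nonneg _)
          ((Zf_integrable _ _ _).const_mul _) (Filter.Eventually.of_forall fun p => Bf_abs γ m q0 ν i p)
    _ = |γ| * 2 ^ ν * ∫ p, Zf m (i / 2 ^ m) (i % 2 ^ m) p ∂mu := integral_const_mul _ _
    _ ≤ |γ| * 2 ^ ν * (1 / 4 ^ m) := mul_le_mul_of_nonneg_left h3 (by positivity)
    _ = _ := by ring

theorem Bf_L2 (γ : ℝ) (m q0 ν i : ℕ) (hi : i < 4 ^ m) :
    ∫ p, (Bf γ m q0 ν i p) ^ 2 ∂mu ≤ (|γ| * 2 ^ ν) ^ 2 / 4 ^ m := by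
  obtain ⟨h1, h2⟩ := idx_bounds hi
  have h3 := Zf_integral m _ _ h1 h2
  calc _ ≤ ∫ p, (|γ| * 2 ^ ν) ^ 2 * Zf m (i / 2 ^ m) (i % 2 ^ m) p ∂mu := by
        refine integral_mono_of_nonneg (Filter.Eventually.of_forall fun p => sq_nonneg _)
          ((Zf_integrable _ _ _).const_mul _) (Filter.Eventually.of_forall fun p => ?_)
        have := pow_le_pow_left₀ (abs_nonneg _) (Bf_abs γ m q0 ν i p) 2
        rw [sq_abs] at this
        refine this.trans (le_of_eq ?_)
        rcases Zf_cases m (i / 2 ^ m) (i % 2 ^ m) p with h | h <;> simp only [h] <;> ring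
    _ = (|γ| * 2 ^ ν) ^ 2 * ∫ p, Zf m (i / 2 ^ m) (i % 2 ^ m) p ∂mu := integral_const_mul _ _
    _ ≤ (|γ| * 2 ^ ν) ^ 2 * (1 / 4 ^ m) := mul_le_mul_of_nonneg_left h3 (by positivity)
    _ = _ := by ring

theorem poly_integral_zero (c S) (h : (0, 0) ∉ S) : ∫ p, poly c S p ∂mu = 0 := by
  have h0 : ∀ a : ℕ × ℕ, ∫ p, psi a p ∂mu = if a = (0, 0) then 1 else 0 := by
    intro a
    rw [← psi_orth]; congr 1; funext p
    have : psi (0, 0) p = 1 := by simp [psi, walsh_zero]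
    rw [this, mul_one]
  unfold poly
  rw [integral_finsetSum _ fun a _ => (psi_integrable a).const_mul _]
  refine Finset.sum_eq_zero fun a ha => ?_
  rw [integral_const_mul, h0, if_neg (by rintro rfl; exact h ha), mul_zero]

section core
variable {γ : ℝ} {m q0 ν : ℕ} {c : ℕ → ℕ × ℕ → ℝ} {A : Finset ℕ}

theorem coeff_sum_bound (hB : ∀ i, Bf γ m q0 ν i = poly (c i) (Sq q0 ν i))
    (hc : ∀ i, ∀ a ∉ Sq q0 ν i, c i a = 0) (hA : A ⊆ Finset.range (4 ^ m)) (δ : ℝ) (hδ : 0 < δ)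
    (S : Finset (ℕ × ℕ)) :
    ∑ a ∈ S, |∑ i ∈ A, c i a| ^ (2 + δ) ≤ (|γ| * 2 ^ ν / 4 ^ m) ^ δ * (|γ| * 2 ^ ν) ^ 2 := by
  set ε := |γ| * 2 ^ ν / 4 ^ m with hε
  have hε0 : 0 ≤ ε := by positivity
  have hsmall : ∀ i ∈ A, ∀ a, |c i a| ≤ ε := by
    intro i hi a
    by_cases ha : a ∈ Sq q0 ν i
    · refine (poly_coeff_le (c i) _ a ha).trans ?_
      rw [← hB]; exact Bf_L1 γ m q0 ν i (Finset.mem_range.1 (hA hi))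
    · rw [hc i a ha]; simpa using hε0
  have h1 : ∀ a, |∑ i ∈ A, c i a| ^ (2 + δ) ≤ ε ^ δ * ∑ i ∈ A, c i a ^ 2 := by
    intro a
    by_cases hex : ∃ i ∈ A, a ∈ Sq q0 ν i
    · obtain ⟨i, hi, ha⟩ := hex
      have e1 : ∑ j ∈ A, c j a = c i a :=
        Finset.sum_eq_single i (fun j _ hj => hc j a fun h => hj (Sq_disj h ha)) (fun h => absurd hi h)
      have e2 : ∑ j ∈ A, c j a ^ 2 = c i a ^ 2 :=
        Finset.sum_eq_single i (fun j _ hj => by rw [hc j a fun h => hj (Sq_disj h ha)]; norm_num) (fun h => absurd hi h)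
      rw [e1, e2, Real.rpow_add_of_nonneg (abs_nonneg _) (by norm_num) hδ.le, mul_comm]
      have : |c i a| ^ (2:ℝ) = c i a ^ 2 := by
        rw [← sq_abs]; exact_mod_cast Real.rpow_natCast _ 2
      rw [this]
      exact mul_le_mul_of_nonneg_right (Real.rpow_le_rpow (abs_nonneg _) (hsmall i hi a) hδ.le) (sq_nonneg _)
    · push Not at hex
      rw [Finset.sum_eq_zero fun i hi => hc i a (hex i hi), abs_zero, Real.zero_rpow (by positivity)]
      exact mul_nonneg (by positivity) (Finset.sum_nonneg fun i _ => sq_nonneg _)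
  calc _ ≤ ∑ a ∈ S, ε ^ δ * ∑ i ∈ A, c i a ^ 2 := Finset.sum_le_sum fun a _ => h1 a
    _ = ε ^ δ * ∑ i ∈ A, ∑ a ∈ S, c i a ^ 2 := by rw [← Finset.mul_sum, Finset.sum_comm]
    _ ≤ ε ^ δ * ∑ i ∈ A, (|γ| * 2 ^ ν) ^ 2 / 4 ^ m := by
        refine mul_le_mul_of_nonneg_left (Finset.sum_le_sum fun i hi => ?_) (by positivity)
        calc ∑ a ∈ S, c i a ^ 2 ≤ ∑ a ∈ S ∪ Sq q0 ν i, c i a ^ 2 :=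
              Finset.sum_le_sum_of_subset_of_nonneg Finset.subset_union_left fun _ _ _ => sq_nonneg _
          _ = ∑ a ∈ Sq q0 ν i, c i a ^ 2 := by
              symm
              exact Finset.sum_subset Finset.subset_union_right fun a _ ha => by rw [hc i a ha]; norm_num
          _ = ∫ p, (Bf γ m q0 ν i p) ^ 2 ∂mu := by rw [hB, poly_parseval]
          _ ≤ _ := Bf_L2 γ m q0 ν i (Finset.mem_range.1 (hA hi))
    _ ≤ ε ^ δ * (|γ| * 2 ^ ν) ^ 2 := by
        refine mul_le_mul_of_nonneg_left ?_ (by positivity)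
        rw [Finset.sum_const, nsmul_eq_mul]
        have hcard : (A.card : ℝ) ≤ 4 ^ m := by
          have := Finset.card_le_card hA
          rw [Finset.card_range] at this
          exact_mod_cast this
        calc (A.card : ℝ) * ((|γ| * 2 ^ ν) ^ 2 / 4 ^ m) ≤ 4 ^ m * ((|γ| * 2 ^ ν) ^ 2 / 4 ^ m) :=
              mul_le_mul_of_nonneg_right hcard (by positivity)
          _ = _ := by field_simp

theorem poly_sum (S : Finset (ℕ × ℕ)) (p : ℝ × ℝ) :
    poly (fun a => ∑ i ∈ A, c i a) S p = ∑ i ∈ A, poly (c i) S p := by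
  unfold poly
  simp_rw [Finset.sum_mul]
  exact Finset.sum_comm

theorem poly_full (hB : ∀ i, Bf γ m q0 ν i = poly (c i) (Sq q0 ν i))
    (hc : ∀ i, ∀ a ∉ Sq q0 ν i, c i a = 0) (i : ℕ) (S : Finset (ℕ × ℕ)) (hS : Sq q0 ν i ⊆ S) (p : ℝ × ℝ) :
    poly (c i) S p = Bf γ m q0 ν i p := by
  rw [hB]; unfold poly
  symm
  exact Finset.sum_subset hS fun a _ ha => by rw [hc i a ha, zero_mul]

theorem poly_partial_L1 (hB : ∀ i, Bf γ m q0 ν i = poly (c i) (Sq q0 ν i))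
    (hc : ∀ i, ∀ a ∉ Sq q0 ν i, c i a = 0) (i : ℕ) (hi : i < 4 ^ m) (S : Finset (ℕ × ℕ)) :
    ∫ p, |poly (c i) S p| ∂mu ≤ |γ| * 2 ^ ν / 2 ^ m := by
  refine (poly_L1_le (c i) S).trans ?_
  refine Real.sqrt_le_iff.2 ⟨by positivity, ?_⟩
  calc ∑ a ∈ S, c i a ^ 2 ≤ ∑ a ∈ S ∪ Sq q0 ν i, c i a ^ 2 :=
        Finset.sum_le_sum_of_subset_of_nonneg Finset.subset_union_left fun _ _ _ => sq_nonneg _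
    _ = ∑ a ∈ Sq q0 ν i, c i a ^ 2 := by
        symm
        exact Finset.sum_subset Finset.subset_union_right fun a _ ha => by rw [hc i a ha]; norm_num
    _ = ∫ p, (Bf γ m q0 ν i p) ^ 2 ∂mu := by rw [hB, poly_parseval]
    _ ≤ _ := Bf_L2 γ m q0 ν i hi
    _ = _ := by
      have : (4:ℝ) ^ m = (2 ^ m) ^ 2 := by rw [← pow_mul, mul_comm, pow_mul]; norm_num
      rw [this, div_pow]

theorem partial_sum (hB : ∀ i, Bf γ m q0 ν i = poly (c i) (Sq q0 ν i))
    (hc : ∀ i, ∀ a ∉ Sq q0 ν i, c i a = 0) (hA : A ⊆ Finset.range (4 ^ m)) (S : Finset (ℕ × ℕ))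
    (hS : ∀ i j, i < j → ∀ a ∈ S, a ∈ Sq q0 ν j → Sq q0 ν i ⊆ S) :
    ∃ F ⊆ A, ∃ R : ℝ × ℝ → ℝ, Integrable R mu ∧ ∫ p, |R p| ∂mu ≤ |γ| * 2 ^ ν / 2 ^ m ∧
      ∀ p, poly (fun a => ∑ i ∈ A, c i a) S p = ∑ i ∈ F, Bf γ m q0 ν i p + R p := by
  refine ⟨A.filter fun i => Sq q0 ν i ⊆ S, Finset.filter_subset _ _,
    fun p => ∑ i ∈ A.filter (fun i => ¬ Sq q0 ν i ⊆ S), poly (c i) S p, ?_, ?_, ?_⟩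
  · exact integrable_finsetSum _ fun i _ => poly_integrable _ _
  · set G := A.filter (fun i => ¬ Sq q0 ν i ⊆ S) with hG
    have hz : ∀ i, (∀ a ∈ S, a ∉ Sq q0 ν i) → ∀ p, poly (c i) S p = 0 := by
      intro i h p
      unfold poly
      exact Finset.sum_eq_zero fun a ha => by rw [hc i a (h a ha), zero_mul]
    by_cases hex : ∃ i ∈ G, ∃ a ∈ S, a ∈ Sq q0 ν i
    · obtain ⟨i, hi, a, haS, ha⟩ := hex
      have hiA := Finset.mem_filter.1 hi
      have : ∀ p, ∑ j ∈ G, poly (c j) S p = poly (c i) S p := by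
        intro p
        refine Finset.sum_eq_single i (fun j hj hji => hz j (fun b hb hbj => ?_) p) (fun h => absurd hi h)
        rcases lt_or_gt_of_ne hji with h | h
        · exact (Finset.mem_filter.1 hj).2 (hS j i h a haS ha)
        · exact hiA.2 (hS i j h b hb hbj)
      simp_rw [this]
      exact poly_partial_L1 hB hc i (Finset.mem_range.1 (hA hiA.1)) S
    · push Not at hex
      have : ∀ p, ∑ j ∈ G, poly (c j) S p = 0 := fun p =>
        Finset.sum_eq_zero fun j hj => hz j (hex j hj) p
      simp_rw [this]
      simp; positivity
  · intro p
    rw [poly_sum, ← Finset.sum_filter_add_sum_filter_not A (fun i => Sq q0 ν i ⊆ S)]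
    congr 1
    exact Finset.sum_congr rfl fun i hi => poly_full hB hc i S (Finset.mem_filter.1 hi).2 p

end core

noncomputable def Kf (m q0 ν : ℕ) (A : Finset ℕ) (p : ℝ × ℝ) : ℝ :=
  ∑ i ∈ A, Zf m (i / 2 ^ m) (i % 2 ^ m) p * Hf (q0 + i * ν) ν p

theorem Kterm_cases (m u v q ν : ℕ) (p : ℝ × ℝ) : Zf m u v p * Hf q ν p = 0 ∨ Zf m u v p * Hf q ν p = 2 ^ ν := by
  rcases Zf_cases m u v p with h | h <;> rcases Hf_cases q ν p with h' | h' <;> rw [h, h'] <;> simp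

theorem Kterm_nonneg (m u v q ν : ℕ) (p : ℝ × ℝ) : 0 ≤ Zf m u v p * Hf q ν p := by
  rcases Kterm_cases m u v q ν p with h | h <;> rw [h]; positivity

theorem Kf_measurable (m q0 ν : ℕ) (A : Finset ℕ) : Measurable (Kf m q0 ν A) :=
  Finset.measurable_fun_sum _ fun _ _ => (Zf_measurable _ _ _).mul (Hf_measurable _ _)

theorem Kf_zero {m q0 ν : ℕ} {A : Finset ℕ} {p : ℝ × ℝ} (h : Kf m q0 ν A p = 0) :
    ∀ i ∈ A, Zf m (i / 2 ^ m) (i % 2 ^ m) p * Hf (q0 + i * ν) ν p = 0 :=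
  (Finset.sum_eq_zero_iff_of_nonneg fun _ _ => Kterm_nonneg _ _ _ _ _ _).1 h

theorem Kf_meas (m q0 ν : ℕ) (hm : m ≤ q0) (A : Finset ℕ) (hA : A ⊆ Finset.range (4 ^ m)) :
    mu.real {p | Kf m q0 ν A p ≠ 0} ≤ 1 / 2 ^ ν := by
  have hterm : ∀ i, Integrable (fun p => Zf m (i / 2 ^ m) (i % 2 ^ m) p * Hf (q0 + i * ν) ν p) mu := fun i =>
    integrable_bdd ((Zf_measurable _ _ _).mul (Hf_measurable _ _)) (2 ^ ν) fun p => by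
      rcases Kterm_cases m (i / 2 ^ m) (i % 2 ^ m) (q0 + i * ν) ν p with h | h <;> rw [h] <;> simp
  have hKint : Integrable (Kf m q0 ν A) mu := integrable_finsetSum _ fun i _ => hterm i
  have h1 := mul_meas_ge_le_integral_of_nonneg (μ := mu)
    (Filter.Eventually.of_forall fun p => Finset.sum_nonneg fun i _ => Kterm_nonneg _ _ _ _ _ _) hKint (2 ^ ν)
  have h2 : ∫ p, Kf m q0 ν A p ∂mu ≤ 1 := by
    obtain ⟨c, hB, hc⟩ := block_coeff 1 m q0 ν hm
    unfold Kf
    rw [integral_finsetSum _ fun i _ => hterm i]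
    have h3 : ∀ i ∈ A, ∫ p, Zf m (i / 2 ^ m) (i % 2 ^ m) p * Hf (q0 + i * ν) ν p ∂mu ≤ 1 / 4 ^ m := by
      intro i hi
      obtain ⟨hu, hv⟩ := idx_bounds (Finset.mem_range.1 (hA hi))
      have e : ∀ p, Zf m (i / 2 ^ m) (i % 2 ^ m) p * Hf (q0 + i * ν) ν p =
          Zf m (i / 2 ^ m) (i % 2 ^ m) p - Bf 1 m q0 ν i p := by
        intro p; unfold Bf; ring
      simp_rw [e]
      rw [hB, integral_sub (Zf_integrable _ _ _) (poly_integrable _ _), poly_integral_zero, sub_zero]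
      · exact Zf_integral m _ _ hu hv
      · rw [mem_Sq]
        rintro ⟨⟨h, _⟩, _⟩
        have : 0 < 2 ^ (q0 + i * ν) := by positivity
        simp only at h; omega
    refine (Finset.sum_le_sum h3).trans ?_
    rw [Finset.sum_const, nsmul_eq_mul]
    have hcard : (A.card : ℝ) ≤ 4 ^ m := by
      have := Finset.card_le_card hA
      rw [Finset.card_range] at this
      exact_mod_cast this
    rw [mul_one_div, div_le_one (by positivity)]
    exact hcard
  have h4 : {p | Kf m q0 ν A p ≠ 0} ⊆ {p | 2 ^ ν ≤ Kf m q0 ν A p} := by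
    intro p hp
    simp only [Set.mem_ofPred_eq] at hp ⊢
    obtain ⟨i, hi, hne⟩ := Finset.exists_ne_zero_of_sum_ne_zero hp
    rw [← (Kterm_cases _ _ _ _ _ _).resolve_left hne]
    exact Finset.single_le_sum (f := fun i => Zf m (i / 2 ^ m) (i % 2 ^ m) p * Hf (q0 + i * ν) ν p)
      (fun j _ => Kterm_nonneg _ _ _ _ _ _) hi
  have h5 := measureReal_mono (μ := mu) h4
  rw [le_div_iff₀ (by positivity), mul_comm]
  exact (mul_le_mul_of_nonneg_left h5 (by positivity)).trans (h1.trans h2)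

/-- Indices of the small squares inside the dyadic square. -/
def Aset (mΔ t i1 i2 : ℕ) : Finset ℕ :=
  (Finset.range (4 ^ (mΔ + t))).filter fun i =>
    i / 2 ^ (mΔ + t) / 2 ^ t + 1 = i1 ∧ i % 2 ^ (mΔ + t) / 2 ^ t + 1 = i2

theorem floor_cond (mΔ t i1 : ℕ) (hi : 1 ≤ i1) (x : ℝ) (hx : 0 ≤ x) (hne : x ≠ (i1:ℝ) / 2 ^ mΔ) :
    ⌊2 ^ (mΔ + t) * x⌋₊ / 2 ^ t + 1 = i1 ↔ x ∈ Set.Icc (((i1 : ℝ) - 1) / 2 ^ mΔ) ((i1 : ℝ) / 2 ^ mΔ) := by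
  have h2 : (0:ℝ) < 2 ^ mΔ := by positivity
  have h0 : ⌊2 ^ (mΔ + t) * x⌋₊ / 2 ^ t = ⌊2 ^ mΔ * x⌋₊ := by
    have := Nat.floor_div_natCast (2 ^ (mΔ + t) * x) (2 ^ t)
    rw [← this]; congr 1; push_cast; rw [pow_add]; field_simp
  obtain ⟨j, rfl⟩ : ∃ j, i1 = j + 1 := ⟨i1 - 1, by omega⟩
  rw [h0, Nat.add_right_cancel_iff, Nat.floor_eq_iff (by positivity), Set.mem_Icc, div_le_iff₀ h2, le_div_iff₀ h2]
  rw [Ne, eq_div_iff h2.ne'] at hne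
  push_cast at hne ⊢
  constructor
  · rintro ⟨h3, h4⟩; constructor <;> linarith
  · rintro ⟨h3, h4⟩
    have := lt_of_le_of_ne h4 hne
    constructor <;> linarith

theorem Zsum (mΔ t i1 i2 : ℕ) (hi1 : 1 ≤ i1) (hi2 : 1 ≤ i2) (p : ℝ × ℝ)
    (hp : p ∈ Set.Ico (0:ℝ) 1 ×ˢ Set.Ico (0:ℝ) 1) (h1 : p.1 ≠ (i1:ℝ) / 2 ^ mΔ) (h2 : p.2 ≠ (i2:ℝ) / 2 ^ mΔ) :
    ∑ i ∈ Aset mΔ t i1 i2, Zf (mΔ + t) (i / 2 ^ (mΔ + t)) (i % 2 ^ (mΔ + t)) p =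
      Set.indicator
          (Set.Icc (((i1 : ℝ) - 1) / 2 ^ mΔ) ((i1 : ℝ) / 2 ^ mΔ) ×ˢ
            Set.Icc (((i2 : ℝ) - 1) / 2 ^ mΔ) ((i2 : ℝ) / 2 ^ mΔ)) (fun _ => (1:ℝ)) p := by
  have hp' := hp
  obtain ⟨⟨hx0, hx1⟩, hy0, hy1⟩ := hp
  have fc1 := floor_cond mΔ t i1 hi1 p.1 hx0 h1
  have fc2 := floor_cond mΔ t i2 hi2 p.2 hy0 h2
  set m := mΔ + t with hm
  have hfl : ∀ x : ℝ, 0 ≤ x → x < 1 → ⌊2 ^ m * x⌋₊ < 2 ^ m := by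
    intro x h0 h1
    rw [Nat.floor_lt (by positivity)]
    push_cast
    have : (0:ℝ) < 2 ^ m := by positivity
    nlinarith
  have hX := hfl p.1 hx0 hx1
  have hY := hfl p.2 hy0 hy1
  set X := ⌊2 ^ m * p.1⌋₊
  set Y := ⌊2 ^ m * p.2⌋₊
  have hpos : 0 < 2 ^ m := by positivity
  have hdiv : (2 ^ m * X + Y) / 2 ^ m = X := by
    rw [Nat.mul_add_div hpos, Nat.div_eq_of_lt hY, add_zero]
  have hmod : (2 ^ m * X + Y) % 2 ^ m = Y := by
    rw [Nat.mul_add_mod, Nat.mod_eq_of_lt hY]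
  have hlt : 2 ^ m * X + Y < 4 ^ m := by
    have : 4 ^ m = 2 ^ m * 2 ^ m := by rw [← mul_pow]; norm_num
    rw [this]; nlinarith
  have hZ : ∀ i ∈ Aset mΔ t i1 i2, Zf m (i / 2 ^ m) (i % 2 ^ m) p = if i = 2 ^ m * X + Y then 1 else 0 := by
    intro i hi
    obtain ⟨hu, hv⟩ := idx_bounds (Finset.mem_range.1 (Finset.mem_filter.1 hi).1)
    rw [Zf_eq m _ _ hu hv p hp']
    have : (⌊2 ^ m * p.1⌋₊ = i / 2 ^ m ∧ ⌊2 ^ m * p.2⌋₊ = i % 2 ^ m) ↔ i = 2 ^ m * X + Y := by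
      constructor
      · rintro ⟨a, b⟩
        have := Nat.div_add_mod i (2 ^ m)
        rw [← a, ← b] at this; exact this.symm
      · rintro rfl; exact ⟨hdiv.symm, hmod.symm⟩
    exact if_congr this rfl rfl
  rw [Finset.sum_congr rfl hZ, Finset.sum_ite_eq', Set.indicator_apply]
  have : 2 ^ m * X + Y ∈ Aset mΔ t i1 i2 ↔ p ∈ Set.Icc (((i1 : ℝ) - 1) / 2 ^ mΔ) ((i1 : ℝ) / 2 ^ mΔ) ×ˢ
            Set.Icc (((i2 : ℝ) - 1) / 2 ^ mΔ) ((i2 : ℝ) / 2 ^ mΔ) := by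
    rw [Aset, Finset.mem_filter, ← hm, hdiv, hmod, fc1, fc2, Set.mem_prod]
    simp [hlt]
  simp only [this]

theorem line_null1 (c : ℝ) : mu {p | p.1 = c} = 0 := by
  have : {p : ℝ × ℝ | p.1 = c} = {c} ×ˢ Set.univ := by ext p; simp
  rw [this, mu, Measure.prod_prod]
  have : mu1 {c} = 0 := le_antisymm ((Measure.restrict_apply_le _ _).trans (by simp)) bot_le
  simp [this]

theorem line_null2 (c : ℝ) : mu {p | p.2 = c} = 0 := by
  have : {p : ℝ × ℝ | p.2 = c} = Set.univ ×ˢ {c} := by ext p; simp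
  rw [this, mu, Measure.prod_prod]
  have : mu1 {c} = 0 := le_antisymm ((Measure.restrict_apply_le _ _).trans (by simp)) bot_le
  simp [this]

theorem choose_params (γ δ : ℝ) (hδ0 : 0 < δ) (mΔ : ℕ) (hγ : γ ≠ 0) : ∃ ν t : ℕ, (1:ℝ) / 2 ^ ν < δ ∧
    (|γ| * 2 ^ ν / 4 ^ (mΔ + t)) ^ δ * (|γ| * 2 ^ ν) ^ 2 < δ ∧
    |γ| * 2 ^ ν / 2 ^ (mΔ + t) ≤ 7 * |γ| * (1 / 4 ^ mΔ) := by
  obtain ⟨ν, hν⟩ := exists_pow_lt_of_lt_one hδ0 (by norm_num : (1/2 : ℝ) < 1)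
  have hg : 0 < |γ| := abs_pos.2 hγ
  have lim : ∀ b : ℝ, 1 < b → Filter.Tendsto (fun t : ℕ => |γ| * 2 ^ ν / b ^ (mΔ + t)) Filter.atTop (nhds 0) := by
    intro b hb
    have h1 := (tendsto_pow_atTop_nhds_zero_of_lt_one (r := b⁻¹) (by positivity) (inv_lt_one_of_one_lt₀ hb)).comp
      (Filter.tendsto_add_atTop_nat mΔ)
    have h2 := h1.const_mul (|γ| * 2 ^ ν)
    rw [mul_zero] at h2
    refine h2.congr fun t => ?_
    simp only [Function.comp]
    rw [inv_pow, add_comm t, div_eq_mul_inv]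
  have l1 := ((lim 4 (by norm_num)).rpow_const (p := δ) (Or.inr hδ0.le)).mul_const ((|γ| * 2 ^ ν) ^ 2)
  rw [Real.zero_rpow hδ0.ne', zero_mul] at l1
  have e1 := l1.eventually (gt_mem_nhds hδ0)
  have e2 := (lim 2 (by norm_num)).eventually (gt_mem_nhds (show 0 < 7 * |γ| * (1 / 4 ^ mΔ) by positivity))
  obtain ⟨t, h1, h2⟩ := (e1.and e2).exists
  exact ⟨ν, t, by rw [← one_div_pow]; exact hν, h1, h2.le⟩

theorem lemma_two (γ : ℝ) (hγ : γ ≠ 0) (δ : ℝ) (hδ0 : 0 < δ) (hδ1 : δ < 1)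
    (N : ℕ) (hN : 1 < N) (mΔ i1 i2 : ℕ)
    (hi1 : 1 ≤ i1 ∧ i1 ≤ 2 ^ mΔ) (hi2 : 1 ≤ i2 ∧ i2 ≤ 2 ^ mΔ) :
    ∃ (E : Set (ℝ × ℝ)) (M : ℕ) (c : ℕ → ℕ → ℝ),
      MeasurableSet E ∧ E ⊆ T ∧ N ≤ M ∧
      volume E > ENNReal.ofReal (1 - δ) ∧
      (∑ k ∈ Finset.Icc N M, ∑ s ∈ Finset.Icc N M, |c k s| ^ (2 + δ) < δ) ∧
      (∀ p ∈ E, ∑ k ∈ Finset.Icc N M, ∑ s ∈ Finset.Icc N M,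
          c k s * walsh k p.1 * walsh s p.2 =
        γ * Set.indicator
          (Set.Icc (((i1 : ℝ) - 1) / 2 ^ mΔ) ((i1 : ℝ) / 2 ^ mΔ) ×ˢ
            Set.Icc (((i2 : ℝ) - 1) / 2 ^ mΔ) ((i2 : ℝ) / 2 ^ mΔ)) (fun _ => (1:ℝ)) p) ∧
      (∀ e ⊆ E, MeasurableSet e →
        ∀ nb ∈ Finset.Icc N M, ∀ mb ∈ Finset.Icc N M,
        ∀ R : ℝ, Real.sqrt 2 * N ≤ R → R ≤ Real.sqrt 2 * M →
        (∫ p in e, |∑ k ∈ Finset.Icc N nb, ∑ s ∈ Finset.Icc N mb,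
            c k s * walsh k p.1 * walsh s p.2|) +
        (∫ p in e, |∑ ks ∈ (Finset.Icc N M ×ˢ Finset.Icc N M).filter
            (fun ks => 2 * N ^ 2 ≤ ks.1 ^ 2 + ks.2 ^ 2 ∧
              ((ks.1 ^ 2 + ks.2 ^ 2 : ℕ) : ℝ) ≤ R ^ 2),
            c ks.1 ks.2 * walsh ks.1 p.1 * walsh ks.2 p.2|) ≤
        16 * |γ| * (volume
          (Set.Icc (((i1 : ℝ) - 1) / 2 ^ mΔ) ((i1 : ℝ) / 2 ^ mΔ) ×ˢ
            Set.Icc (((i2 : ℝ) - 1) / 2 ^ mΔ) ((i2 : ℝ) / 2 ^ mΔ))).toReal) := by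
  obtain ⟨ν, t, hν, hcoef, hη⟩ := choose_params γ δ hδ0 mΔ hγ
  set m := mΔ + t with hm
  set q0 := m + N with hq0
  set A := Aset mΔ t i1 i2 with hAdef
  have hA : A ⊆ Finset.range (4 ^ m) := Finset.filter_subset _ _
  obtain ⟨c, hB, hc⟩ := block_coeff γ m q0 ν (by omega)
  set Δ : Set (ℝ × ℝ) := Set.Icc (((i1 : ℝ) - 1) / 2 ^ mΔ) ((i1 : ℝ) / 2 ^ mΔ) ×ˢ
            Set.Icc (((i2 : ℝ) - 1) / 2 ^ mΔ) ((i2 : ℝ) / 2 ^ mΔ) with hΔ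
  have hΔm : MeasurableSet Δ := measurableSet_Icc.prod measurableSet_Icc
  have hΔvol : volume Δ = ENNReal.ofReal (1 / 4 ^ mΔ) := by
    rw [hΔ, Measure.volume_eq_prod, Measure.prod_prod, Real.volume_Icc, Real.volume_Icc, ← ENNReal.ofReal_mul]
    · congr 1
      have : (4:ℝ) ^ mΔ = 2 ^ mΔ * 2 ^ mΔ := by rw [← mul_pow]; norm_num
      rw [this]; field_simp; ring
    · rw [← sub_div]; simp
  have hΔreal : (volume Δ).toReal = 1 / 4 ^ mΔ := by
    rw [hΔvol, ENNReal.toReal_ofReal (by positivity)]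
  set Q : Set (ℝ × ℝ) := Set.Ico (0:ℝ) 1 ×ˢ Set.Ico (0:ℝ) 1 with hQ
  have hQm : MeasurableSet Q := measurableSet_Ico.prod measurableSet_Ico
  set Bad : Set (ℝ × ℝ) := {p | Kf m q0 ν A p ≠ 0} ∪ ({p | p.1 = (i1:ℝ) / 2 ^ mΔ} ∪ {p | p.2 = (i2:ℝ) / 2 ^ mΔ}) with hBad
  have hBadm : MeasurableSet Bad := by
    refine MeasurableSet.union ?_ (MeasurableSet.union ?_ ?_)
    · exact (measurableSet_eq_fun (Kf_measurable m q0 ν A) measurable_const).compl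
    · exact measurableSet_eq_fun measurable_fst measurable_const
    · exact measurableSet_eq_fun measurable_snd measurable_const
  have hBadmu : mu.real Bad < δ := by
    refine lt_of_le_of_lt ?_ hν
    refine (measureReal_union_le _ _).trans ?_
    have h0 : mu.real ({p : ℝ × ℝ | p.1 = (i1:ℝ) / 2 ^ mΔ} ∪ {p | p.2 = (i2:ℝ) / 2 ^ mΔ}) = 0 := by
      rw [measureReal_def, measure_union_null (line_null1 _) (line_null2 _)]; rfl
    rw [h0, add_zero]
    exact Kf_meas m q0 ν (by omega) A hA
  set M := 2 ^ (q0 + 4 ^ m * ν) with hM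
  have hNq : N ≤ 2 ^ q0 := (Nat.lt_two_pow_self.le).trans (Nat.pow_le_pow_right (by norm_num) (by omega))
  have hSqN : ∀ i, ∀ a ∈ Sq q0 ν i, N ≤ a.1 ∧ N ≤ a.2 := by
    intro i a ha
    rw [mem_Sq] at ha
    have : 2 ^ q0 ≤ 2 ^ (q0 + i * ν) := Nat.pow_le_pow_right (by norm_num) (by omega)
    omega
  have hSqM : ∀ i ∈ A, ∀ a ∈ Sq q0 ν i, a.1 ≤ M ∧ a.2 ≤ M := by
    intro i hi a ha
    rw [mem_Sq] at ha
    have hlt := Finset.mem_range.1 (hA hi)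
    have : 2 ^ (q0 + (i+1) * ν) ≤ M := by
      refine Nat.pow_le_pow_right (by norm_num) (Nat.add_le_add_left (Nat.mul_le_mul_right _ hlt) _)
    omega
  have hfull : ∀ i ∈ A, Sq q0 ν i ⊆ Finset.Icc N M ×ˢ Finset.Icc N M := by
    intro i hi a ha
    have h1 := hSqN i a ha
    have h2 := hSqM i hi a ha
    simp only [Finset.mem_product, Finset.mem_Icc]; omega
  set C : ℕ × ℕ → ℝ := fun a => ∑ i ∈ A, c i a with hC
  have hBE : ∀ p ∈ Q \ Bad, ∀ i ∈ A, Bf γ m q0 ν i p = γ * Zf m (i / 2 ^ m) (i % 2 ^ m) p := by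
    intro p hp i hi
    have hK : Kf m q0 ν A p = 0 := by
      by_contra h; exact hp.2 (Or.inl h)
    have := Kf_zero hK i hi
    unfold Bf
    rw [mul_sub, mul_one, this, sub_zero]
  have hZE : ∀ p ∈ Q \ Bad, ∑ i ∈ A, Zf m (i / 2 ^ m) (i % 2 ^ m) p = Δ.indicator (fun _ => (1:ℝ)) p := by
    intro p hp
    exact Zsum mΔ t i1 i2 hi1.1 hi2.1 p hp.1 (fun h => hp.2 (Or.inr (Or.inl h))) (fun h => hp.2 (Or.inr (Or.inr h)))
  have hpart : ∀ S : Finset (ℕ × ℕ), (∀ i j, i < j → ∀ a ∈ S, a ∈ Sq q0 ν j → Sq q0 ν i ⊆ S) →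
      ∀ e ⊆ Q \ Bad, MeasurableSet e → ∫ p in e, |poly C S p| ≤ 8 * |γ| * (1 / 4 ^ mΔ) := by
    intro S hS e he hem
    obtain ⟨F, hFA, R, hRint, hRle, hsum⟩ := partial_sum hB hc hA S hS
    have hle : volume.restrict e ≤ mu := by
      rw [mu_eq]
      exact Measure.restrict_mono (fun p hp => (he hp).1) le_rfl
    set g : ℝ × ℝ → ℝ := fun p => |γ| * Δ.indicator (fun _ => (1:ℝ)) p + |R p| with hg
    have hind : Integrable (Δ.indicator (fun _ => (1:ℝ))) mu := (integrable_const (1:ℝ)).indicator hΔm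
    have hgint : Integrable g mu := (hind.const_mul _).add hRint.abs
    have hg0 : ∀ p, 0 ≤ g p := fun p =>
      add_nonneg (mul_nonneg (abs_nonneg _) (Set.indicator_nonneg (fun _ _ => zero_le_one) _)) (abs_nonneg _)
    calc ∫ p in e, |poly C S p| ≤ ∫ p in e, g p := by
          refine setIntegral_mono_on ((poly_integrable C S).abs.mono_measure hle) (hgint.mono_measure hle) hem ?_
          intro p hp
          rw [hsum p]
          refine (abs_add_le _ _).trans (add_le_add_left ?_ _)
          rw [← hZE p (he hp), Finset.mul_sum]
          refine (Finset.abs_sum_le_sum_abs _ _).trans ?_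
          have hnn : ∀ i, 0 ≤ Zf m (i / 2 ^ m) (i % 2 ^ m) p := fun i => by
            rcases Zf_cases m (i / 2 ^ m) (i % 2 ^ m) p with h | h <;> rw [h]
            exact zero_le_one
          refine (Finset.sum_le_sum (g := fun i => |γ| * Zf m (i / 2 ^ m) (i % 2 ^ m) p) fun i hi => ?_).trans
            (Finset.sum_le_sum_of_subset_of_nonneg hFA fun i _ _ => mul_nonneg (abs_nonneg _) (hnn i))
          rw [hBE p (he hp) i (hFA hi), abs_mul, abs_of_nonneg (hnn i)]
      _ ≤ ∫ p, g p ∂mu := integral_mono_measure hle (Filter.Eventually.of_forall hg0) hgint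
      _ = |γ| * mu.real Δ + ∫ p, |R p| ∂mu := by
          rw [hg, integral_add (hind.const_mul _) hRint.abs, integral_const_mul, integral_indicator hΔm,
            setIntegral_const, smul_eq_mul, mul_one]
      _ ≤ |γ| * (1 / 4 ^ mΔ) + 7 * |γ| * (1 / 4 ^ mΔ) := by
          refine add_le_add (mul_le_mul_of_nonneg_left ?_ (abs_nonneg _)) (hRle.trans hη)
          have h1 : mu Δ ≤ volume Δ := by rw [mu_eq]; exact Measure.restrict_apply_le _ _
          rw [hΔvol] at h1
          exact ENNReal.toReal_le_of_le_ofReal (by positivity) h1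
      _ = 8 * |γ| * (1 / 4 ^ mΔ) := by ring
  refine ⟨Q \ Bad, M, fun k s => C (k, s), hQm.diff hBadm, ?_, ?_, ?_, ?_, ?_, ?_⟩
  · intro p hp
    exact ⟨⟨hp.1.1.1, hp.1.1.2.le⟩, hp.1.2.1, hp.1.2.2.le⟩
  · exact hNq.trans (Nat.pow_le_pow_right (by norm_num) (by omega))
  · have h1 : volume (Q \ Bad) = mu Badᶜ := by
      rw [mu_eq, Measure.restrict_apply hBadm.compl, Set.sdiff_eq, Set.inter_comm]
    rw [gt_iff_lt, h1, ENNReal.ofReal_lt_iff_lt_toReal (by linarith) (measure_ne_top _ _)]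
    have := probReal_compl_eq_one_sub (μ := mu) hBadm
    rw [← measureReal_def, this]; linarith
  · rw [← Finset.sum_product']
    exact lt_of_le_of_lt (coeff_sum_bound hB hc hA δ hδ0 _) hcoef
  · intro p hp
    have e1 : ∑ k ∈ Finset.Icc N M, ∑ s ∈ Finset.Icc N M, C (k, s) * walsh k p.1 * walsh s p.2 =
        poly C (Finset.Icc N M ×ˢ Finset.Icc N M) p := by
      rw [poly, Finset.sum_product]; simp only [psi, mul_assoc]
    rw [e1, poly_sum, ← hZE p hp, Finset.mul_sum]
    refine Finset.sum_congr rfl fun i hi => ?_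
    rw [poly_full hB hc i _ (hfull i hi), hBE p hp i hi]
  · intro e he hem nb hnb mb hmb R hR1 hR2
    rw [hΔreal]
    have e1 : ∀ p : ℝ × ℝ, ∑ k ∈ Finset.Icc N nb, ∑ s ∈ Finset.Icc N mb, C (k, s) * walsh k p.1 * walsh s p.2 =
        poly C (Finset.Icc N nb ×ˢ Finset.Icc N mb) p := by
      intro p
      rw [poly, Finset.sum_product]; simp only [psi, mul_assoc]
    have e2 : ∀ S : Finset (ℕ × ℕ), ∀ p : ℝ × ℝ, ∑ ks ∈ S, C (ks.1, ks.2) * walsh ks.1 p.1 * walsh ks.2 p.2 =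
        poly C S p := by
      intro S p
      simp only [poly, psi, mul_assoc]
    simp only [e1, e2]
    have b1 := hpart (Finset.Icc N nb ×ˢ Finset.Icc N mb) (by
      intro i j hij a haS ha b hb
      have h1 := Sq_lt hij hb ha
      have h2 := hSqN i b hb
      simp only [Finset.mem_product, Finset.mem_Icc] at haS ⊢
      omega) e he hem
    have b2 := hpart ((Finset.Icc N M ×ˢ Finset.Icc N M).filter
            (fun ks => 2 * N ^ 2 ≤ ks.1 ^ 2 + ks.2 ^ 2 ∧
              ((ks.1 ^ 2 + ks.2 ^ 2 : ℕ) : ℝ) ≤ R ^ 2)) (by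
      intro i j hij a haS ha b hb
      have h1 := Sq_lt hij hb ha
      have h2 := hSqN i b hb
      simp only [Finset.mem_filter, Finset.mem_product, Finset.mem_Icc] at haS ⊢
      refine ⟨by omega, ?_, le_trans ?_ haS.2.2⟩
      · have := Nat.pow_le_pow_left h2.1 2
        have := Nat.pow_le_pow_left h2.2 2
        omega
      · have := Nat.pow_le_pow_left h1.1.le 2
        have := Nat.pow_le_pow_left h1.2.le 2
        exact_mod_cast (by omega : b.1 ^ 2 + b.2 ^ 2 ≤ a.1 ^ 2 + a.2 ^ 2)) e he hem
    linarith
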